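/- arXiv:2311.10235 — 6 statements merged into one kernel-verified Lean document; each statement's English description precedes it below -/
import Mathlib

section
/- Let N be a natural number, let S, M, H₀ be N×N real matrices, and let γ be a real number with 0 < γ ≤ 1. Suppose there exist constants C ≥ 0 and r with 0 ≤ r < 1 such that ‖M^k‖ ≤ C·r^k for all k ≥ 0 (Frobenius norm). Define the sequence (Hᵢ) by H₀ given and H_{i+1} = S + γ • (Mᵀ * Hᵢ * M). Then Hᵢ converges, as i → ∞, to H* := ∑_{j=0}^{∞} γ^j • ((Mᵀ)^j * S * M^j), and this limit is independent of the initial matrix H₀. -/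
open Matrix Filter

attribute [local instance] Matrix.frobeniusNormedAddCommGroup

attribute [local instance] Matrix.frobeniusNormedSpace

/-- The discounted congruence terms `γ ^ j • ((Mᵀ) ^ j * X * M ^ j)` are summable whenever the
powers of `M` decay geometrically. -/
theorem summable_pow_smul_transpose_pow_mul_mul_pow {n : Type*} [Fintype n] [DecidableEq n]
    {M : Matrix n n ℝ} {γ C r : ℝ} (hγ0 : 0 ≤ γ) (hγ1 : γ ≤ 1) (hC : 0 ≤ C) (hr0 : 0 ≤ r)
    (hr1 : r < 1) (hM : ∀ k : ℕ, ‖M ^ k‖ ≤ C * r ^ k) (X : Matrix n n ℝ) :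
    Summable fun j : ℕ => γ ^ j • ((Mᵀ) ^ j * X * M ^ j) := by
  have : CompleteSpace (Matrix n n ℝ) := FiniteDimensional.complete ℝ _
  have hgeom : Summable fun j : ℕ => C ^ 2 * ‖X‖ * (r ^ 2) ^ j :=
    (summable_geometric_of_lt_one (by positivity) (by nlinarith)).mul_left _
  refine Summable.of_norm_bounded hgeom fun j => ?_
  have hT : ‖(Mᵀ) ^ j‖ ≤ C * r ^ j := by
    rw [← transpose_pow, frobenius_norm_transpose]
    exact hM j
  calc ‖γ ^ j • ((Mᵀ) ^ j * X * M ^ j)‖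
      = γ ^ j * ‖(Mᵀ) ^ j * X * M ^ j‖ := by
        rw [norm_smul, Real.norm_of_nonneg (by positivity)]
    _ ≤ 1 * ‖(Mᵀ) ^ j * X * M ^ j‖ := by
        gcongr
        exact pow_le_one₀ hγ0 hγ1
    _ ≤ ‖(Mᵀ) ^ j‖ * ‖X‖ * ‖M ^ j‖ := by
        rw [one_mul]
        refine (frobenius_norm_mul _ _).trans ?_
        gcongr
        exact frobenius_norm_mul _ _
    _ ≤ C * r ^ j * ‖X‖ * (C * r ^ j) := by
        gcongr
        exact hM j
    _ = C ^ 2 * ‖X‖ * (r ^ 2) ^ j := by ring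

/-- Closed form of the iteration `H (i + 1) = S + γ • (Mᵀ * H i * M)`. -/
theorem eq_sum_range_add_of_bellman_recursion {n : Type*} [Fintype n] [DecidableEq n]
    {S M : Matrix n n ℝ} {γ : ℝ} {H : ℕ → Matrix n n ℝ}
    (hrec : ∀ i : ℕ, H (i + 1) = S + γ • (Mᵀ * H i * M)) (i : ℕ) :
    H i = ∑ j ∈ Finset.range i, γ ^ j • ((Mᵀ) ^ j * S * M ^ j) +
      γ ^ i • ((Mᵀ) ^ i * H 0 * M ^ i) := by
  have hstep (X : Matrix n n ℝ) (j : ℕ) :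
      γ • (Mᵀ * (γ ^ j • ((Mᵀ) ^ j * X * M ^ j)) * M) =
        γ ^ (j + 1) • ((Mᵀ) ^ (j + 1) * X * M ^ (j + 1)) := by
    rw [pow_succ' Mᵀ, pow_succ M, pow_succ' γ, Matrix.mul_smul, Matrix.smul_mul, smul_smul]
    simp only [Matrix.mul_assoc]
  induction i with
  | zero => simp
  | succ i ih =>
    rw [hrec, ih, Matrix.mul_add, Matrix.add_mul, smul_add, hstep, Finset.mul_sum,
      Finset.sum_mul, Finset.smul_sum, Finset.sum_range_succ']
    simp only [hstep, pow_zero, one_smul, Matrix.one_mul, Matrix.mul_one]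
    abel

theorem stmt_3 (N : ℕ) (S M H₀ : Matrix (Fin N) (Fin N) ℝ) (γ : ℝ)
    (hγ0 : 0 < γ) (hγ1 : γ ≤ 1)
    (C r : ℝ) (hC : 0 ≤ C) (hr0 : 0 ≤ r) (hr1 : r < 1)
    (hM : ∀ k : ℕ, ‖M ^ k‖ ≤ C * r ^ k)
    (H : ℕ → Matrix (Fin N) (Fin N) ℝ)
    (hH0 : H 0 = H₀)
    (hrec : ∀ i : ℕ, H (i + 1) = S + γ • (Mᵀ * H i * M)) :
    Tendsto H atTop (nhds (∑' j : ℕ, γ ^ j • ((Mᵀ) ^ j * S * M ^ j))) := by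
  have hsum := summable_pow_smul_transpose_pow_mul_mul_pow hγ0.le hγ1 hC hr0 hr1 hM
  have hlim := (hsum S).hasSum.tendsto_sum_nat.add (hsum (H 0)).tendsto_atTop_zero
  rw [add_zero] at hlim
  exact hlim.congr fun i => (eq_sum_range_add_of_bellman_recursion hrec i).symm
end

section
/- Let N be a natural number, let S, M be N×N real matrices, and let γ be a real number with 0 < γ ≤ 1. Suppose there exist constants C ≥ 0 and r with 0 ≤ r < 1 such that ‖M^k‖ ≤ C·r^k for all k ≥ 0 (Frobenius norm). Then the matrix H* := ∑_{j=0}^{∞} γ^j • ((Mᵀ)^j * S * M^j) satisfies the fixed-point equation H* = S + γ • (Mᵀ * H* * M). -/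
open Matrix

attribute [local instance] Matrix.frobeniusNormedAddCommGroup

/-- The Lyapunov series of a matrix with geometrically decaying powers is summable. -/
theorem summable_lyapunov_series {n : Type*} [Fintype n] [DecidableEq n]
    (S M : Matrix n n ℝ) {γ C r : ℝ} (hγ0 : 0 ≤ γ) (hγ1 : γ ≤ 1)
    (hr0 : 0 ≤ r) (hr1 : r < 1) (hM : ∀ k : ℕ, ‖M ^ k‖ ≤ C * r ^ k) :
    Summable fun j : ℕ => γ ^ j • (Mᵀ ^ j * S * M ^ j) := by
  let _ : NormedSpace ℝ (Matrix n n ℝ) := Matrix.frobeniusNormedSpace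
  have : CompleteSpace (Matrix n n ℝ) := FiniteDimensional.complete ℝ _
  have hgeom : Summable fun j : ℕ => C ^ 2 * ‖S‖ * (r ^ 2) ^ j :=
    (summable_geometric_of_lt_one (sq_nonneg r) (by nlinarith)).mul_left _
  refine Summable.of_norm_bounded hgeom fun j => ?_
  have hbound : 0 ≤ C * r ^ j := (norm_nonneg _).trans (hM j)
  have htranspose : ‖Mᵀ ^ j‖ ≤ C * r ^ j := by
    rw [← transpose_pow, frobenius_norm_transpose]
    exact hM j
  have hprod : ‖Mᵀ ^ j * S * M ^ j‖ ≤ C * r ^ j * ‖S‖ * (C * r ^ j) :=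
    calc ‖Mᵀ ^ j * S * M ^ j‖ ≤ ‖Mᵀ ^ j * S‖ * ‖M ^ j‖ := frobenius_norm_mul _ _
      _ ≤ ‖Mᵀ ^ j‖ * ‖S‖ * ‖M ^ j‖ := by gcongr; exact frobenius_norm_mul _ _
      _ ≤ C * r ^ j * ‖S‖ * (C * r ^ j) := by gcongr; exact hM j
  calc ‖γ ^ j • (Mᵀ ^ j * S * M ^ j)‖ = γ ^ j * ‖Mᵀ ^ j * S * M ^ j‖ := by
        rw [norm_smul, Real.norm_of_nonneg (pow_nonneg hγ0 j)]
    _ ≤ 1 * (C * r ^ j * ‖S‖ * (C * r ^ j)) := by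
        gcongr
        exact pow_le_one₀ hγ0 hγ1
    _ = C ^ 2 * ‖S‖ * (r ^ 2) ^ j := by ring

theorem stmt_4 (N : ℕ) (S M : Matrix (Fin N) (Fin N) ℝ) (γ : ℝ)
    (hγ0 : 0 < γ) (hγ1 : γ ≤ 1)
    (C r : ℝ) (hC : 0 ≤ C) (hr0 : 0 ≤ r) (hr1 : r < 1)
    (hM : ∀ k : ℕ, ‖M ^ k‖ ≤ C * r ^ k) :
    (∑' j : ℕ, γ ^ j • ((Mᵀ) ^ j * S * M ^ j))
      = S + γ • (Mᵀ * (∑' j : ℕ, γ ^ j • ((Mᵀ) ^ j * S * M ^ j)) * M) := by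
  have hsum := summable_lyapunov_series S M hγ0.le hγ1 hr0 hr1 hM
  have hshift : ∀ j : ℕ, γ ^ (j + 1) • (Mᵀ ^ (j + 1) * S * M ^ (j + 1)) =
      γ • (Mᵀ * (γ ^ j • (Mᵀ ^ j * S * M ^ j)) * M) := fun j => by
    rw [pow_succ' γ, pow_succ' Mᵀ, pow_succ M, mul_smul, Matrix.mul_smul, Matrix.smul_mul]
    simp only [Matrix.mul_assoc]
  rw [← hsum.tsum_mul_left, ← (hsum.mul_left Mᵀ).tsum_mul_right,
    ← ((hsum.mul_left Mᵀ).mul_right M).tsum_const_smul, hsum.tsum_eq_zero_add]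
  simp only [hshift, pow_zero, one_smul, Matrix.one_mul, Matrix.mul_one]
end

section
/- Let n and m be natural numbers, let A be an n×n real matrix, B an n×m real matrix, K an m×n real matrix, Q an n×n real matrix, R an m×m real matrix, γ a real number, and let P be an n×n real matrix satisfying the Lyapunov equation P = Q + Kᵀ*R*K + γ•((A−B*K)ᵀ*P*(A−B*K)). Define H = fromBlocks (Q + γ•(Aᵀ*P*A)) (γ•(Aᵀ*P*B)) (γ•(Bᵀ*P*A)) (R + γ•(Bᵀ*P*B)). Then for every x : Fin n → ℝ and u : Fin m → ℝ, writing z = Sum.elim x u, x' = A.mulVec x + B.mulVec u, u' = −(K.mulVec x'), and z' = Sum.elim x' u', one has zᵀ H z = xᵀ Q x + uᵀ R u + γ·(z'ᵀ H z'). -/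
open Matrix

/-- Moving a transposed left factor of a bilinear form onto its left argument. -/
theorem dotProduct_transpose_mul_mul_mulVec {ι κ μ ν : Type*} [Fintype ι] [Fintype κ]
    [Fintype μ] [Fintype ν] (M : Matrix ι κ ℝ) (W : Matrix ι μ ℝ) (N : Matrix μ ν ℝ)
    (v : κ → ℝ) (w : ν → ℝ) :
    v ⬝ᵥ (Mᵀ * W * N) *ᵥ w = (M *ᵥ v) ⬝ᵥ W *ᵥ (N *ᵥ w) := by
  rw [← mulVec_mulVec, ← mulVec_mulVec, dotProduct_mulVec v, vecMul_transpose]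

/-- The block quadratic form is the stage cost plus the discounted value of the successor state. -/
theorem sumElim_dotProduct_fromBlocks_mulVec {ι κ : Type*} [Fintype ι] [Fintype κ]
    (A : Matrix ι ι ℝ) (B : Matrix ι κ ℝ) (Q P : Matrix ι ι ℝ) (R : Matrix κ κ ℝ) (γ : ℝ)
    (x : ι → ℝ) (u : κ → ℝ) :
    Sum.elim x u ⬝ᵥ (fromBlocks (Q + γ • (Aᵀ * P * A)) (γ • (Aᵀ * P * B))
      (γ • (Bᵀ * P * A)) (R + γ • (Bᵀ * P * B))) *ᵥ Sum.elim x u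
      = x ⬝ᵥ Q *ᵥ x + u ⬝ᵥ R *ᵥ u
        + γ * ((A *ᵥ x + B *ᵥ u) ⬝ᵥ P *ᵥ (A *ᵥ x + B *ᵥ u)) := by
  simp only [fromBlocks_mulVec, Sum.elim_comp_inl, Sum.elim_comp_inr, sumElim_dotProduct_sumElim,
    add_mulVec, smul_mulVec, dotProduct_add, dotProduct_smul, smul_eq_mul,
    dotProduct_transpose_mul_mul_mulVec, mulVec_add, add_dotProduct]
  ring

/-- The quadratic form of a Lyapunov solution satisfies the Bellman equation of the policy. -/
theorem dotProduct_mulVec_of_lyapunov {ι κ : Type*} [Fintype ι] [Fintype κ]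
    {A : Matrix ι ι ℝ} {B : Matrix ι κ ℝ} {K : Matrix κ ι ℝ} {Q P : Matrix ι ι ℝ}
    {R : Matrix κ κ ℝ} {γ : ℝ}
    (hP : P = Q + Kᵀ * R * K + γ • ((A - B * K)ᵀ * P * (A - B * K))) (y : ι → ℝ) :
    y ⬝ᵥ P *ᵥ y = y ⬝ᵥ Q *ᵥ y + (-(K *ᵥ y)) ⬝ᵥ R *ᵥ (-(K *ᵥ y))
      + γ * ((A *ᵥ y + B *ᵥ (-(K *ᵥ y))) ⬝ᵥ P *ᵥ (A *ᵥ y + B *ᵥ (-(K *ᵥ y)))) := by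
  have hy : A *ᵥ y + B *ᵥ (-(K *ᵥ y)) = (A - B * K) *ᵥ y := by
    rw [sub_mulVec, mulVec_neg, mulVec_mulVec, sub_eq_add_neg]
  conv_lhs => rw [hP]
  rw [hy, add_mulVec, add_mulVec, smul_mulVec, dotProduct_add, dotProduct_add, dotProduct_smul,
    dotProduct_transpose_mul_mul_mulVec, dotProduct_transpose_mul_mul_mulVec, mulVec_neg,
    neg_dotProduct_neg, smul_eq_mul]

theorem stmt_10 (n m : ℕ)
    (A : Matrix (Fin n) (Fin n) ℝ) (B : Matrix (Fin n) (Fin m) ℝ)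
    (K : Matrix (Fin m) (Fin n) ℝ)
    (Q : Matrix (Fin n) (Fin n) ℝ) (R : Matrix (Fin m) (Fin m) ℝ)
    (γ : ℝ) (P : Matrix (Fin n) (Fin n) ℝ)
    (hP : P = Q + Kᵀ * R * K + γ • ((A - B * K)ᵀ * P * (A - B * K)))
    (H : Matrix (Fin n ⊕ Fin m) (Fin n ⊕ Fin m) ℝ)
    (hH : H = Matrix.fromBlocks (Q + γ • (Aᵀ * P * A)) (γ • (Aᵀ * P * B))
      (γ • (Bᵀ * P * A)) (R + γ • (Bᵀ * P * B))) :
    ∀ (x : Fin n → ℝ) (u : Fin m → ℝ),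
      (Sum.elim x u) ⬝ᵥ H.mulVec (Sum.elim x u)
        = x ⬝ᵥ Q.mulVec x + u ⬝ᵥ R.mulVec u
          + γ * ((Sum.elim (A.mulVec x + B.mulVec u)
                    (-(K.mulVec (A.mulVec x + B.mulVec u)))) ⬝ᵥ
                  H.mulVec (Sum.elim (A.mulVec x + B.mulVec u)
                    (-(K.mulVec (A.mulVec x + B.mulVec u))))) := by
  intro x u
  rw [hH, sumElim_dotProduct_fromBlocks_mulVec, sumElim_dotProduct_fromBlocks_mulVec,
    ← dotProduct_mulVec_of_lyapunov hP]
end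

section
/- Let n and m be natural numbers, let A be an n×n real matrix, B an n×m real matrix, Q an n×n real symmetric matrix, R an m×m real positive definite matrix, P an n×n real positive semidefinite matrix, and γ a real number with γ > 0. Define K' := (R + γ•(Bᵀ*P*B))⁻¹ * (γ•(Bᵀ*P*A)). Then for every x : Fin n → ℝ and every u : Fin m → ℝ, writing u' = −(K'.mulVec x), one has x ⬝ᵥ Q.mulVec x + u' ⬝ᵥ R.mulVec u' + γ·((A.mulVec x + B.mulVec u') ⬝ᵥ P.mulVec (A.mulVec x + B.mulVec u')) ≤ x ⬝ᵥ Q.mulVec x + u ⬝ᵥ R.mulVec u + γ·((A.mulVec x + B.mulVec u) ⬝ᵥ P.mulVec (A.mulVec x + B.mulVec u)). -/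
open Matrix

/-- First-order expansion of a real quadratic form, bounded below by its linearization. -/
lemma Matrix.PosSemidef.linearization_le_quadForm_add {ι : Type*} [Fintype ι]
    {M : Matrix ι ι ℝ} (hM : M.PosSemidef) (a b : ι → ℝ) :
    a ⬝ᵥ M *ᵥ a + 2 * (b ⬝ᵥ M *ᵥ a) ≤ (a + b) ⬝ᵥ M *ᵥ (a + b) := by
  have hsymm : Mᵀ = M := by simpa [conjTranspose_eq_transpose_of_trivial] using hM.isHermitian.eq
  have hcross : a ⬝ᵥ M *ᵥ b = b ⬝ᵥ M *ᵥ a := by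
    rw [dotProduct_mulVec, ← mulVec_transpose, hsymm, dotProduct_comm]
  have hnonneg : 0 ≤ b ⬝ᵥ M *ᵥ b := by simpa using hM.dotProduct_mulVec_nonneg b
  simp only [mulVec_add, add_dotProduct, dotProduct_add]
  linarith

/-- The improved input is a stationary point of the Bellman right-hand side. -/
lemma improvedInput_stationary {ι κ : Type*} [Fintype ι] [Fintype κ] [DecidableEq κ]
    (A : Matrix ι ι ℝ) (B : Matrix ι κ ℝ) {R : Matrix κ κ ℝ} (hR : R.PosDef)
    {P : Matrix ι ι ℝ} (hP : P.PosSemidef) {γ : ℝ} (hγ : 0 ≤ γ) (x : ι → ℝ) {v : κ → ℝ}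
    (hv : v = -(((R + γ • (Bᵀ * P * B))⁻¹ * (γ • (Bᵀ * P * A))) *ᵥ x)) :
    R *ᵥ v + γ • (Bᵀ *ᵥ P *ᵥ (A *ᵥ x + B *ᵥ v)) = 0 := by
  have hBPB : (Bᵀ * P * B).PosSemidef := by
    simpa [conjTranspose_eq_transpose_of_trivial] using hP.conjTranspose_mul_mul_same B
  have hH : (R + γ • (Bᵀ * P * B)).PosDef := hR.add_posSemidef (hBPB.smul hγ)
  have hnormal : (R + γ • (Bᵀ * P * B)) *ᵥ v = -((γ • (Bᵀ * P * A)) *ᵥ x) := by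
    rw [hv, mulVec_neg, mulVec_mulVec,
      mul_nonsing_inv_cancel_left _ _ ((isUnit_iff_isUnit_det _).mp hH.isUnit)]
  simp only [add_mulVec, smul_mulVec, ← mulVec_mulVec] at hnormal
  rw [mulVec_add, mulVec_add, smul_add, add_left_comm, hnormal, add_neg_cancel]

theorem stmt_14 (n m : ℕ)
    (A : Matrix (Fin n) (Fin n) ℝ) (B : Matrix (Fin n) (Fin m) ℝ)
    (Q : Matrix (Fin n) (Fin n) ℝ) (hQ : Qᵀ = Q)
    (R : Matrix (Fin m) (Fin m) ℝ) (hR : R.PosDef)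
    (P : Matrix (Fin n) (Fin n) ℝ) (hP : P.PosSemidef)
    (γ : ℝ) (hγ : 0 < γ)
    (K' : Matrix (Fin m) (Fin n) ℝ)
    (hK' : K' = (R + γ • (Bᵀ * P * B))⁻¹ * (γ • (Bᵀ * P * A))) :
    ∀ (x : Fin n → ℝ) (u : Fin m → ℝ),
      x ⬝ᵥ Q.mulVec x + (-(K'.mulVec x)) ⬝ᵥ R.mulVec (-(K'.mulVec x))
        + γ * ((A.mulVec x + B.mulVec (-(K'.mulVec x))) ⬝ᵥ
            P.mulVec (A.mulVec x + B.mulVec (-(K'.mulVec x))))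
      ≤ x ⬝ᵥ Q.mulVec x + u ⬝ᵥ R.mulVec u
        + γ * ((A.mulVec x + B.mulVec u) ⬝ᵥ P.mulVec (A.mulVec x + B.mulVec u)) := by
  intro x u
  generalize hv : -(K' *ᵥ x) = v
  obtain ⟨d, rfl⟩ : ∃ d, u = v + d := ⟨u - v, by simp⟩
  have hstat := congrArg (d ⬝ᵥ ·)
    (improvedInput_stationary A B hR hP hγ.le x (v := v) (by rw [← hv, hK']))
  simp only [dotProduct_add, dotProduct_smul, dotProduct_zero, smul_eq_mul] at hstat
  rw [dotProduct_mulVec d Bᵀ, vecMul_transpose] at hstat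
  have hRle := hR.posSemidef.linearization_le_quadForm_add v d
  have hPle := mul_le_mul_of_nonneg_left
    (hP.linearization_le_quadForm_add (A *ᵥ x + B *ᵥ v) (B *ᵥ d)) hγ.le
  rw [mulVec_add B v d, ← add_assoc (A *ᵥ x)]
  linarith
end

section
/- Let n and m be natural numbers, let A be an n×n real matrix, B an n×m real matrix, Q an n×n real positive semidefinite matrix, R an m×m real positive definite matrix, and γ a real number with 0 < γ ≤ 1. Let K be an m×n real matrix and let P be an n×n real positive semidefinite matrix satisfying P = Q + Kᵀ*R*K + γ•((A−B*K)ᵀ*P*(A−B*K)). Define K' := (R + γ•(Bᵀ*P*B))⁻¹ * (γ•(Bᵀ*P*A)) and suppose there exist C ≥ 0 and r ∈ [0,1) such that ‖(A − B*K')^k‖ ≤ C·r^k for all k ≥ 0 (Frobenius norm). Let P' := ∑_{k=0}^{∞} γ^k • (((A−B*K')ᵀ)^k * (Q + K'ᵀ*R*K') * (A−B*K')^k). Then P − P' is positive semidefinite. -/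
open Matrix

attribute [local instance] Matrix.frobeniusNormedAddCommGroup

/-- Completing the square: the one-step cost of the gain `K` exceeds that of a gain `K'` solving
`(R + γ BᵀPB) K' = γ BᵀPA` by the quadratic form of `R + γ BᵀPB` at `K - K'`. -/
theorem lqr_complete_square {ι κ : Type*} [Fintype ι] [Fintype κ]
    {A P : Matrix ι ι ℝ} {B : Matrix ι κ ℝ} {R : Matrix κ κ ℝ} {K K' : Matrix κ ι ℝ} {γ : ℝ}
    (hR : Rᵀ = R) (hP : Pᵀ = P)
    (hK' : (R + γ • (Bᵀ * P * B)) * K' = γ • (Bᵀ * P * A)) :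
    Kᵀ * R * K + γ • ((A - B * K)ᵀ * P * (A - B * K)) =
      K'ᵀ * R * K' + γ • ((A - B * K')ᵀ * P * (A - B * K')) +
        (K - K')ᵀ * (R + γ • (Bᵀ * P * B)) * (K - K') := by
  set M := R + γ • (Bᵀ * P * B) with hM
  have hMt : Mᵀ = M := by simp [hM, hR, hP, Matrix.mul_assoc]
  have hK't : K'ᵀ * M = γ • (Aᵀ * P * B) := by
    have h := congrArg Matrix.transpose hK'
    simpa [hMt, hP, Matrix.mul_assoc] using h
  have expand (X : Matrix κ ι ℝ) :
      Xᵀ * R * X + γ • ((A - B * X)ᵀ * P * (A - B * X)) =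
        γ • (Aᵀ * P * A) - Xᵀ * (M * K') - K'ᵀ * M * X + Xᵀ * M * X := by
    rw [hK', hK't, hM]
    simp only [transpose_sub, transpose_mul, Matrix.sub_mul, Matrix.mul_sub, Matrix.add_mul,
      Matrix.mul_add, Matrix.smul_mul, Matrix.mul_smul, smul_sub, Matrix.mul_assoc]
    abel
  rw [expand K, expand K']
  simp only [transpose_sub, Matrix.sub_mul, Matrix.mul_sub, Matrix.mul_assoc]
  abel

/-- A positive semidefinite supersolution of the discounted Lyapunov equation dominates every
partial sum of the value series. -/
theorem posSemidef_sub_sum_lyapunov {ι : Type*} [Fintype ι] [DecidableEq ι]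
    {L P W : Matrix ι ι ℝ} {γ : ℝ} (hγ : 0 ≤ γ) (hP : P.PosSemidef)
    (h : (P - W - γ • (Lᵀ * P * L)).PosSemidef) (N : ℕ) :
    (P - ∑ k ∈ Finset.range N, γ ^ k • (Lᵀ ^ k * W * L ^ k)).PosSemidef := by
  have conj {X : Matrix ι ι ℝ} (hX : X.PosSemidef) (k : ℕ) :
      (γ ^ k • (Lᵀ ^ k * X * L ^ k)).PosSemidef := by
    have := (hX.conjTranspose_mul_mul_same (L ^ k)).smul (pow_nonneg hγ k)
    simpa [conjTranspose_eq_transpose_of_trivial, transpose_pow] using this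
  have key : (P - ∑ k ∈ Finset.range N, γ ^ k • (Lᵀ ^ k * W * L ^ k)
      - γ ^ N • (Lᵀ ^ N * P * L ^ N)).PosSemidef := by
    induction N with
    | zero => simpa using PosSemidef.zero
    | succ N ih =>
      convert ih.add (conj h N) using 1
      rw [Finset.sum_range_succ, pow_succ Lᵀ, pow_succ' L, pow_succ γ]
      simp only [Matrix.sub_mul, Matrix.mul_sub, Matrix.smul_mul, Matrix.mul_smul, smul_sub,
        smul_smul, Matrix.mul_assoc]
      abel
  simpa using key.add (conj hP N)

/-- The positive semidefinite real matrices form a closed set. -/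
theorem isClosed_setOf_posSemidef {ι : Type*} [Fintype ι] :
    IsClosed {X : Matrix ι ι ℝ | X.PosSemidef} := by
  simp only [posSemidef_iff_dotProduct_mulVec, Set.ofPred_and, Set.ofPred_forall]
  refine IsClosed.inter ?_ (isClosed_iInter fun v => ?_)
  · exact isClosed_eq (by fun_prop) continuous_id
  · exact isClosed_le continuous_const (by fun_prop)

theorem stmt_15 (n m : ℕ)
    (A : Matrix (Fin n) (Fin n) ℝ) (B : Matrix (Fin n) (Fin m) ℝ)
    (Q : Matrix (Fin n) (Fin n) ℝ) (hQ : Q.PosSemidef)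
    (R : Matrix (Fin m) (Fin m) ℝ) (hR : R.PosDef)
    (γ : ℝ) (hγ0 : 0 < γ) (hγ1 : γ ≤ 1)
    (K : Matrix (Fin m) (Fin n) ℝ)
    (P : Matrix (Fin n) (Fin n) ℝ) (hPsd : P.PosSemidef)
    (hP : P = Q + Kᵀ * R * K + γ • ((A - B * K)ᵀ * P * (A - B * K)))
    (K' : Matrix (Fin m) (Fin n) ℝ)
    (hK' : K' = (R + γ • (Bᵀ * P * B))⁻¹ * (γ • (Bᵀ * P * A)))
    (C r : ℝ) (hC : 0 ≤ C) (hr0 : 0 ≤ r) (hr1 : r < 1)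
    (hdecay : ∀ k : ℕ, ‖(A - B * K') ^ k‖ ≤ C * r ^ k)
    (P' : Matrix (Fin n) (Fin n) ℝ)
    (hP' : P' = ∑' k : ℕ,
      γ ^ k • (((A - B * K')ᵀ) ^ k * (Q + K'ᵀ * R * K') * (A - B * K') ^ k)) :
    (P - P').PosSemidef := by
  have hM : (R + γ • (Bᵀ * P * B)).PosDef := by
    have h := (hPsd.conjTranspose_mul_mul_same B).smul hγ0.le
    rw [conjTranspose_eq_transpose_of_trivial] at h
    exact hR.add_posSemidef h
  have hMK' : (R + γ • (Bᵀ * P * B)) * K' = γ • (Bᵀ * P * A) := by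
    rw [hK', mul_nonsing_inv_cancel_left _ _ ((isUnit_iff_isUnit_det _).mp hM.isUnit)]
  have hsq := lqr_complete_square (R := R) (P := P) (K := K) hR.1 hPsd.1 hMK'
  have hsuper : (P - (Q + K'ᵀ * R * K')
      - γ • ((A - B * K')ᵀ * P * (A - B * K'))).PosSemidef := by
    have h := hM.posSemidef.conjTranspose_mul_mul_same (K - K')
    rw [conjTranspose_eq_transpose_of_trivial] at h
    convert h using 1
    rw [add_assoc, hsq] at hP
    rw [sub_sub, sub_eq_iff_eq_add]
    refine hP.trans ?_
    abel
  subst hP'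
  by_cases hs : Summable fun k : ℕ =>
      γ ^ k • (((A - B * K')ᵀ) ^ k * (Q + K'ᵀ * R * K') * (A - B * K') ^ k)
  · exact isClosed_setOf_posSemidef.mem_of_tendsto (hs.hasSum.tendsto_sum_nat.const_sub P)
      (Filter.Eventually.of_forall (posSemidef_sub_sum_lyapunov hγ0.le hPsd hsuper))
  · rwa [tsum_eq_zero_of_not_summable hs, sub_zero]
end

section
/- Let N be a natural number, let S, M be N×N real matrices with S positive semidefinite, and let γ be a real number with 0 < γ ≤ 1. Suppose there exist constants C ≥ 0 and r with 0 ≤ r < 1 such that ‖M^k‖ ≤ C·r^k for all k ≥ 0 (Frobenius norm). Then H* := ∑_{j=0}^{∞} γ^j • ((Mᵀ)^j * S * M^j) is positive semidefinite; if moreover S is positive definite, then H* is positive definite. -/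
open Matrix

attribute [local instance] Matrix.frobeniusNormedAddCommGroup

theorem Matrix.PosSemidef.of_hasSum {ι n : Type*} [Fintype n] {f : ι → Matrix n n ℝ}
    {A : Matrix n n ℝ} (hf : ∀ i, (f i).PosSemidef) (hA : HasSum f A) : A.PosSemidef := by
  refine .of_dotProduct_mulVec_nonneg ?_ fun x ↦ ?_
  · refine hA.matrix_conjTranspose.unique ?_
    simpa only [(hf _).isHermitian.eq] using hA
  · have hx : HasSum (fun i ↦ star x ⬝ᵥ (f i *ᵥ x)) (star x ⬝ᵥ (A *ᵥ x)) :=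
      hA.map (AddMonoidHom.mk' (fun B : Matrix n n ℝ ↦ star x ⬝ᵥ (B *ᵥ x))
        fun B B' ↦ by rw [add_mulVec, dotProduct_add])
        (continuous_const.dotProduct (continuous_id.matrix_mulVec continuous_const))
    exact hx.nonneg fun i ↦ (hf i).dotProduct_mulVec_nonneg x

theorem Matrix.PosDef.of_hasSum {n : Type*} [Fintype n] {f : ℕ → Matrix n n ℝ}
    {A : Matrix n n ℝ} (hf : ∀ i, (f i).PosSemidef) (h0 : (f 0).PosDef) (hA : HasSum f A) :
    A.PosDef := by
  have htail : (A - f 0).PosSemidef :=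
    .of_hasSum (f := fun i ↦ f (i + 1)) (fun i ↦ hf _) <| by
      simpa using (hasSum_nat_add_iff' 1).2 hA
  simpa using h0.add_posSemidef htail

/-- The discounted Lyapunov series converges when the powers of `M` decay geometrically. -/
theorem summable_discounted_lyapunov {n : Type*} [Fintype n] [DecidableEq n] (S M : Matrix n n ℝ)
    {γ : ℝ} (hγ0 : 0 ≤ γ) (hγ1 : γ ≤ 1) {C r : ℝ} (hr0 : 0 ≤ r) (hr1 : r < 1)
    (hM : ∀ k : ℕ, ‖M ^ k‖ ≤ C * r ^ k) :
    Summable fun j : ℕ ↦ γ ^ j • (Mᵀ ^ j * S * M ^ j) := by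
  let : NormedSpace ℝ (Matrix n n ℝ) := Matrix.frobeniusNormedSpace
  have : CompleteSpace (Matrix n n ℝ) := FiniteDimensional.complete ℝ _
  have hgeom : Summable fun j : ℕ ↦ C * ‖S‖ * C * (r ^ 2) ^ j :=
    (summable_geometric_of_lt_one (by positivity) (by nlinarith)).mul_left _
  refine hgeom.of_norm_bounded fun j ↦ ?_
  have hT : ‖Mᵀ ^ j‖ ≤ C * r ^ j := by
    rw [← transpose_pow, frobenius_norm_transpose]
    exact hM j
  have hCr : 0 ≤ C * r ^ j := (norm_nonneg _).trans hT
  calc ‖γ ^ j • (Mᵀ ^ j * S * M ^ j)‖ = γ ^ j * ‖Mᵀ ^ j * S * M ^ j‖ := by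
        rw [norm_smul, Real.norm_of_nonneg (by positivity)]
    _ ≤ 1 * ‖Mᵀ ^ j * S * M ^ j‖ := by gcongr; exact pow_le_one₀ hγ0 hγ1
    _ ≤ ‖Mᵀ ^ j‖ * ‖S‖ * ‖M ^ j‖ := by
        rw [one_mul]
        exact (frobenius_norm_mul _ _).trans (by gcongr; exact frobenius_norm_mul _ _)
    _ ≤ C * r ^ j * ‖S‖ * (C * r ^ j) := by gcongr; exact hM j
    _ = C * ‖S‖ * C * (r ^ 2) ^ j := by ring

theorem stmt_16 (N : ℕ) (S M : Matrix (Fin N) (Fin N) ℝ)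
    (hS : S.PosSemidef)
    (γ : ℝ) (hγ0 : 0 < γ) (hγ1 : γ ≤ 1)
    (C r : ℝ) (hC : 0 ≤ C) (hr0 : 0 ≤ r) (hr1 : r < 1)
    (hM : ∀ k : ℕ, ‖M ^ k‖ ≤ C * r ^ k) :
    (∑' j : ℕ, γ ^ j • ((Mᵀ) ^ j * S * M ^ j)).PosSemidef ∧
    (S.PosDef → (∑' j : ℕ, γ ^ j • ((Mᵀ) ^ j * S * M ^ j)).PosDef) := by
  have hsum := (summable_discounted_lyapunov S M hγ0.le hγ1 hr0 hr1 hM).hasSum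
  have hterm (j : ℕ) : (γ ^ j • (Mᵀ ^ j * S * M ^ j)).PosSemidef := by
    rw [← transpose_pow, ← conjTranspose_eq_transpose_of_trivial]
    exact (hS.conjTranspose_mul_mul_same _).smul (by positivity)
  exact ⟨.of_hasSum hterm hsum, fun hS' ↦ .of_hasSum hterm (by simpa using hS') hsum⟩
end
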